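/- In the setting of the truncated semidefinite relaxation of the measure-norm minimization: let α^{(N)} be the minimal value of program (TrunSDP)_N, attained at a minimizer with first component a^{(N)} ∈ ℝ^m, and let α^opt be the minimal value of program (Main). Define δ^{(N)} = [‖ρ − Σ_{i=1}^m a_i^{(N)} λ_i‖_{TV} + (η/ε)‖a^{(N)}‖_{p′}] − α^{(N)}. Then δ^{(N)} ≥ 0 and α^{(N)} ≤ α^opt ≤ α^{(N)} + δ^{(N)}. -/

import Mathlib

open MeasureTheory Polynomial
open scoped ENNReal

noncomputable section

/-- The symmetric Toeplitz matrix with entries `(Toep z) j k = z_{|j-k|}` (0-indexed). -/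
def Toep {N : ℕ} (z : Fin N → ℝ) : Matrix (Fin N) (Fin N) ℝ :=
  Matrix.of fun j k => z ⟨Nat.dist j.1 k.1, by
    have hj := j.isLt; have hk := k.isLt; simp only [Nat.dist]; omega⟩

/-- Integral of a function against a finite signed Borel measure on `[-1,1]`,
via the Jordan decomposition. -/
def sInt (ν : SignedMeasure (Set.Icc (-1:ℝ) 1)) (f : (Set.Icc (-1:ℝ) 1) → ℝ) : ℝ :=
  (∫ x, f x ∂ν.toJordanDecomposition.posPart) - ∫ x, f x ∂ν.toJordanDecomposition.negPart

/-- Total variation norm of a signed measure on `[-1,1]`. -/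
def tvNorm (ν : SignedMeasure (Set.Icc (-1:ℝ) 1)) : ℝ := (ν.totalVariation Set.univ).toReal

/-- Truncated Chebyshev moment vector `M_N(ν) = (∫ T_{k-1} dν)_{k=1}^N` (0-indexed). -/
def chebMom (N : ℕ) (ν : SignedMeasure (Set.Icc (-1:ℝ) 1)) : Fin N → ℝ :=
  fun k => sInt ν (fun x => (Polynomial.Chebyshev.T ℝ ((k : ℕ) : ℤ)).eval (x : ℝ))

/-- Objective of program (Main). -/
def mainObj {m : ℕ} (lam : Fin m → SignedMeasure (Set.Icc (-1:ℝ) 1))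
    (ρ : SignedMeasure (Set.Icc (-1:ℝ) 1)) (ε η : ℝ) (p' : ℝ≥0∞) [Fact (1 ≤ p')]
    (a : Fin m → ℝ) : ℝ :=
  tvNorm (ρ - ∑ i, a i • lam i) + η / ε * ‖(WithLp.equiv p' (Fin m → ℝ)).symm a‖

/-- `a` is a minimizer of program (Main). -/
def IsMainMin {m n : ℕ} (lam : Fin m → SignedMeasure (Set.Icc (-1:ℝ) 1))
    (ρ : SignedMeasure (Set.Icc (-1:ℝ) 1)) (Mmat : Matrix (Fin n) (Fin m) ℝ)
    (bvec : Fin n → ℝ) (ε η : ℝ) (p' : ℝ≥0∞) [Fact (1 ≤ p')]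
    (a : Fin m → ℝ) : Prop :=
  Mmat.mulVec a = bvec ∧ ∀ a' : Fin m → ℝ, Mmat.mulVec a' = bvec →
    mainObj lam ρ ε η p' a ≤ mainObj lam ρ ε η p' a'

/-- Feasibility for program (TrunSDP)_N. -/
def trunFeas {m n N : ℕ} (lam : Fin m → SignedMeasure (Set.Icc (-1:ℝ) 1))
    (ρ : SignedMeasure (Set.Icc (-1:ℝ) 1)) (Mmat : Matrix (Fin n) (Fin m) ℝ)
    (bvec : Fin n → ℝ) (a : Fin m → ℝ) (zp zm : Fin N → ℝ) : Prop :=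
  Mmat.mulVec a = bvec ∧ zp - zm = chebMom N (ρ - ∑ i, a i • lam i) ∧
    (Toep zp).PosSemidef ∧ (Toep zm).PosSemidef

/-- Objective of program (TrunSDP)_N. -/
def trunObj {m N : ℕ} (hN : 0 < N) (ε η : ℝ) (p' : ℝ≥0∞) [Fact (1 ≤ p')]
    (a : Fin m → ℝ) (zp zm : Fin N → ℝ) : ℝ :=
  zp ⟨0, hN⟩ + zm ⟨0, hN⟩ + η / ε * ‖(WithLp.equiv p' (Fin m → ℝ)).symm a‖


/-- The truncated Chebyshev moment vector of a positive measure. -/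
def posChebMom (N : ℕ) (μ : Measure (Set.Icc (-1:ℝ) 1)) : Fin N → ℝ :=
  fun k => ∫ x, (Polynomial.Chebyshev.T ℝ ((k : ℕ) : ℤ)).eval (x : ℝ) ∂μ

theorem eval_chebyshev_T_natDist (x : Set.Icc (-1:ℝ) 1) (j k : ℕ) :
    (Polynomial.Chebyshev.T ℝ ((Nat.dist j k : ℕ) : ℤ)).eval (x : ℝ) =
      Real.cos (j * Real.arccos x) * Real.cos (k * Real.arccos x) +
        Real.sin (j * Real.arccos x) * Real.sin (k * Real.arccos x) := by
  conv_lhs => rw [← Real.cos_arccos x.2.1 x.2.2]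
  rw [Polynomial.Chebyshev.T_real_cos, ← Real.cos_sub]
  rcases le_total j k with h | h
  · rw [Nat.dist_eq_sub_of_le h, ← Real.cos_neg]
    push_cast [h]
    ring_nf
  · rw [Nat.dist_eq_sub_of_le_right h]
    push_cast [h]
    ring_nf

theorem toep_posChebMom_posSemidef (N : ℕ) (μ : Measure (Set.Icc (-1:ℝ) 1))
    [IsFiniteMeasure μ] : (Toep (posChebMom N μ)).PosSemidef := by
  refine Matrix.PosSemidef.of_dotProduct_mulVec_nonneg ?_ fun y => ?_
  · ext j k
    simp [Toep, Nat.dist_comm]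
  · have hintegrable : ∀ j k : Fin N, Integrable (fun x : Set.Icc (-1:ℝ) 1 =>
        y j * ((Polynomial.Chebyshev.T ℝ ((Nat.dist j k : ℕ) : ℤ)).eval (x : ℝ) * y k)) μ := by
      intro j k
      have hc : Continuous (fun x : Set.Icc (-1:ℝ) 1 =>
        y j * ((Polynomial.Chebyshev.T ℝ ((Nat.dist j k : ℕ) : ℤ)).eval (x : ℝ) * y k)) := by
        fun_prop
      exact hc.integrable_of_hasCompactSupport (HasCompactSupport.of_compactSpace _)
    have hform : star y ⬝ᵥ (Toep (posChebMom N μ)).mulVec y =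
        ∫ x : Set.Icc (-1:ℝ) 1, ((∑ j, y j * Real.cos ((j : ℕ) * Real.arccos x)) ^ 2 +
          (∑ j, y j * Real.sin ((j : ℕ) * Real.arccos x)) ^ 2) ∂μ := by
      calc star y ⬝ᵥ (Toep (posChebMom N μ)).mulVec y
          = ∑ j : Fin N, ∑ k : Fin N, ∫ x : Set.Icc (-1:ℝ) 1, y j *
              ((Polynomial.Chebyshev.T ℝ ((Nat.dist j k : ℕ) : ℤ)).eval (x : ℝ) * y k) ∂μ := by
            simp only [dotProduct, Matrix.mulVec, Toep, posChebMom, Matrix.of_apply,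
              Finset.mul_sum, integral_const_mul, integral_mul_const, Pi.star_apply, star_trivial]
        _ = ∫ x : Set.Icc (-1:ℝ) 1, ∑ j : Fin N, ∑ k : Fin N, y j *
              ((Polynomial.Chebyshev.T ℝ ((Nat.dist j k : ℕ) : ℤ)).eval (x : ℝ) * y k) ∂μ := by
            rw [integral_finsetSum _ fun j _ =>
              integrable_finsetSum _ fun k _ => hintegrable j k]
            exact Finset.sum_congr rfl fun j _ =>
              (integral_finsetSum _ fun k _ => hintegrable j k).symm
        _ = _ := by
            congr 1 with x
            simp only [sq, Finset.sum_mul_sum, ← Finset.sum_add_distrib]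
            refine Finset.sum_congr rfl fun j _ => Finset.sum_congr rfl fun k _ => ?_
            rw [eval_chebyshev_T_natDist]
            ring
    rw [hform]
    exact integral_nonneg fun x => by positivity

theorem tvNorm_eq_posChebMom_add {N : ℕ} (hN : 0 < N) (ν : SignedMeasure (Set.Icc (-1:ℝ) 1)) :
    tvNorm ν = posChebMom N ν.toJordanDecomposition.posPart ⟨0, hN⟩ +
      posChebMom N ν.toJordanDecomposition.negPart ⟨0, hN⟩ := by
  simp [tvNorm, posChebMom, SignedMeasure.totalVariation, measureReal_def,
    ENNReal.toReal_add (measure_ne_top _ _) (measure_ne_top _ _)]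

/-- The objective of (Main) at a feasible point is attained in (TrunSDP)_N by the moment vectors
of the Jordan decomposition. -/
theorem exists_trunFeas_trunObj_eq_mainObj {m n N : ℕ} (hN : 0 < N)
    (lam : Fin m → SignedMeasure (Set.Icc (-1:ℝ) 1))
    (ρ : SignedMeasure (Set.Icc (-1:ℝ) 1)) (Mmat : Matrix (Fin n) (Fin m) ℝ)
    (bvec : Fin n → ℝ) (ε η : ℝ) (p' : ℝ≥0∞) [Fact (1 ≤ p')] (a : Fin m → ℝ)
    (ha : Mmat.mulVec a = bvec) :
    ∃ zp zm : Fin N → ℝ, trunFeas lam ρ Mmat bvec a zp zm ∧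
      trunObj hN ε η p' a zp zm = mainObj lam ρ ε η p' a :=
  ⟨posChebMom N _, posChebMom N _, ⟨ha, rfl,
    toep_posChebMom_posSemidef N _, toep_posChebMom_posSemidef N _⟩,
    by rw [mainObj, trunObj, tvNorm_eq_posChebMom_add hN]⟩

/-- (Theorem 4.4 of the paper.) A posteriori bound: with
`δ^{(N)} = [‖ρ - Σ aᵢ^{(N)} λᵢ‖_TV + (η/ε)‖a^{(N)}‖_{p'}] - α^{(N)}`, one has `δ^{(N)} ≥ 0`
and `α^{(N)} ≤ α^opt ≤ α^{(N)} + δ^{(N)}`. -/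
theorem trunSDP_a_posteriori_bound
    {m n N : ℕ} (hnm : n ≤ m) (hN : 0 < N)
    (lam : Fin m → SignedMeasure (Set.Icc (-1:ℝ) 1))
    (ρ : SignedMeasure (Set.Icc (-1:ℝ) 1))
    -- a basis of the n-dimensional subspace V of C[-1,1]
    (v : Fin n → C(Set.Icc (-1:ℝ) 1, ℝ)) (hv : LinearIndependent ℝ v)
    (Mmat : Matrix (Fin n) (Fin m) ℝ)
    (hM : Mmat = Matrix.of fun j i => sInt (lam i) (v j))
    (bvec : Fin n → ℝ) (hb : bvec = fun j => sInt ρ (v j))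
    (ε η : ℝ) (hε : 0 < ε) (hη : 0 < η)
    (p p' : ℝ≥0∞) [Fact (1 ≤ p)] [Fact (1 ≤ p')] (hpp' : p⁻¹ + p'⁻¹ = 1)
    -- (aN, zp, zm) is a minimizer of (TrunSDP)_N, with minimal value α^{(N)}
    (aN : Fin m → ℝ) (zp zm : Fin N → ℝ)
    (hfeas : trunFeas lam ρ Mmat bvec aN zp zm)
    (hmin : ∀ (a' : Fin m → ℝ) (zp' zm' : Fin N → ℝ),
      trunFeas lam ρ Mmat bvec a' zp' zm' →
      trunObj hN ε η p' aN zp zm ≤ trunObj hN ε η p' a' zp' zm')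
    (αN : ℝ) (hαN : αN = trunObj hN ε η p' aN zp zm)
    -- α^opt is the minimal value of (Main), attained at some minimizer
    (aopt : Fin m → ℝ) (hopt : IsMainMin lam ρ Mmat bvec ε η p' aopt)
    (αopt : ℝ) (hαopt : αopt = mainObj lam ρ ε η p' aopt)
    -- the a posteriori discrepancy δ^{(N)}
    (δN : ℝ) (hδN : δN = mainObj lam ρ ε η p' aN - αN) :
    0 ≤ δN ∧ αN ≤ αopt ∧ αopt ≤ αN + δN := by
  obtain ⟨zp₁, zm₁, hfeas₁, hobj₁⟩ :=
    exists_trunFeas_trunObj_eq_mainObj hN lam ρ Mmat bvec ε η p' aN hfeas.1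
  obtain ⟨zp₂, zm₂, hfeas₂, hobj₂⟩ :=
    exists_trunFeas_trunObj_eq_mainObj hN lam ρ Mmat bvec ε η p' aopt hopt.1
  have h₁ := hmin _ _ _ hfeas₁
  have h₂ := hmin _ _ _ hfeas₂
  have h₃ := hopt.2 aN hfeas.1
  refine ⟨?_, ?_, ?_⟩ <;> linarith

end
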